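/- Let ε > 0 be a constant. For every deterministic online strategy of Builder that never purchases more than (3/4 − ε)·n edges among e_1, …, e_{τ_1}, for all sufficiently large n the probability that Builder's graph B_{τ_1} has an isolated vertex is at least ε³/100. -/

import Mathlib

open Finset Filter

namespace RGP

/-- Number of edges of the complete graph on `n` vertices. -/
def numEdges (n : ℕ) : ℕ := n * (n - 1) / 2

/-- An edge of the complete graph on `Fin n` (an unordered pair of distinct vertices). -/
abbrev EdgeType (n : ℕ) := {e : Sym2 (Fin n) // ¬ e.IsDiag}

/-- A uniformly random permutation of the edges of `K_n` is modelled by a bijection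
`σ` between positions `Fin (numEdges n)` and edges; `σ i` is the edge `e_{i+1}`. -/
abbrev Ord (n : ℕ) := Fin (numEdges n) ≃ EdgeType n

/-- Degree of a vertex `v` in a set `S` of edges. -/
def deg {n : ℕ} (S : Finset (Sym2 (Fin n))) (v : Fin n) : ℕ :=
  (S.filter (fun e => v ∈ e)).card

/-- The edge set `{e_1, …, e_m}` of `G_{n,m}` in the random graph process `σ`. -/
def procEdges {n : ℕ} (σ : Ord n) (m : ℕ) : Finset (Sym2 (Fin n)) :=
  (Finset.univ.filter (fun i : Fin (numEdges n) => (i : ℕ) < m)).image (fun i => (σ i).1)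

/-- The hitting time `τ_k` for minimum degree at least `k`. -/
noncomputable def tau {n : ℕ} (k : ℕ) (σ : Ord n) : ℕ :=
  sInf {m | ∀ v : Fin n, k ≤ deg (procEdges σ m) v}

open scoped Classical in
/-- The probability of an event under the uniformly random edge ordering. -/
noncomputable def Pr {n : ℕ} (p : Ord n → Prop) : ℝ :=
  ((Finset.univ : Finset (Ord n)).filter p).card / (Fintype.card (Ord n) : ℝ)

/-- A deterministic online strategy: given the sequence of edges revealed so far
(the last entry being the edge just revealed), decide whether to purchase it. -/
abbrev Strategy (n : ℕ) := List (Sym2 (Fin n)) → Bool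

/-- The list of the first `i` revealed edges `e_1, …, e_i`. -/
def prefixList {n : ℕ} (σ : Ord n) (i : ℕ) : List (Sym2 (Fin n)) :=
  (List.range i).filterMap (fun j => if h : j < numEdges n then some (σ ⟨j, h⟩).1 else none)

/-- `buy st σ i` is the edge set of Builder's graph `B_i`: the edges purchased by the
strategy `st` among `e_1, …, e_i`. -/
def buy {n : ℕ} (st : Strategy n) (σ : Ord n) : ℕ → Finset (Sym2 (Fin n))
  | 0 => ∅
  | i + 1 =>
    if h : i < numEdges n then
      if st (prefixList σ (i + 1)) then insert (σ ⟨i, h⟩).1 (buy st σ i)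
      else buy st σ i
    else buy st σ i

end RGP

namespace RGP

variable {n : ℕ}

/-- Position of an edge in the ordering. -/
def pos (σ : Ord n) (e : EdgeType n) : ℕ := (σ.symm e : Fin (numEdges n))

/-- `z` is isolated in the graph of the first `t` edges. -/
def iso (σ : Ord n) (t : ℕ) (z : Fin n) : Prop := ∀ e : EdgeType n, z ∈ e.1 → t ≤ pos σ e

lemma pos_inj (σ : Ord n) {e f : EdgeType n} (h : pos σ e = pos σ f) : e = f :=
  σ.symm.injective (Fin.ext h)

lemma iso_anti (σ : Ord n) {s t : ℕ} (h : s ≤ t) {z : Fin n} (hz : iso σ t z) : iso σ s z :=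
  fun e he => h.trans (hz e he)

/-- Swapping `x` and `v` on edges avoiding `y`. -/
def thetaS (x y v : Fin n) (f : Sym2 (Fin n)) : Sym2 (Fin n) :=
  if y ∈ f then f else f.map (Equiv.swap x v)

def thetaF (x y v : Fin n) (f : EdgeType n) : EdgeType n :=
  ⟨thetaS x y v f.1, by
    unfold thetaS
    split_ifs
    · exact f.2
    · rw [Sym2.isDiag_map (Equiv.swap x v).injective]; exact f.2⟩

lemma mem_map_swap (x v z : Fin n) (f : Sym2 (Fin n)) :
    z ∈ f.map (Equiv.swap x v) ↔ Equiv.swap x v z ∈ f := by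
  rw [Sym2.mem_map]
  constructor
  · rintro ⟨a, ha, rfl⟩; simpa using ha
  · intro h; exact ⟨_, h, by simp⟩

lemma thetaF_invol {x y v : Fin n} (hx : y ≠ x) (hv : y ≠ v) :
    Function.Involutive (thetaF x y v) := by
  intro f
  apply Subtype.ext
  show thetaS x y v (thetaS x y v f.1) = f.1
  by_cases h : y ∈ f.1
  · simp [thetaS, h]
  · have h2 : y ∉ f.1.map (Equiv.swap x v) := by
      rw [mem_map_swap, Equiv.swap_apply_of_ne_of_ne hx hv]; exact h
    simp only [thetaS, h, h2, if_false, Sym2.map_map]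
    have : (Equiv.swap x v : Fin n → Fin n) ∘ (Equiv.swap x v) = id := by
      funext a; simp
    rw [this]; simp

open scoped Classical in
noncomputable def theta (x y v : Fin n) : Equiv.Perm (EdgeType n) :=
  if h : y ≠ x ∧ y ≠ v then (thetaF_invol h.1 h.2).toPerm else 1

lemma theta_apply {x y v : Fin n} (hx : y ≠ x) (hv : y ≠ v) (f : EdgeType n) :
    theta x y v f = thetaF x y v f := by
  simp [theta, hx, hv]

lemma theta_theta {x y v : Fin n} (hx : y ≠ x) (hv : y ≠ v) (f : EdgeType n) :
    theta x y v (theta x y v f) = f := by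
  rw [theta_apply hx hv, theta_apply hx hv, thetaF_invol hx hv]

lemma theta_of_mem {x y v : Fin n} (hx : y ≠ x) (hv : y ≠ v) {f : EdgeType n} (h : y ∈ f.1) :
    theta x y v f = f := by
  rw [theta_apply hx hv]; apply Subtype.ext; simp [thetaF, thetaS, h]

lemma theta_val {x y v : Fin n} (hx : y ≠ x) (hv : y ≠ v) {f : EdgeType n} (h : y ∉ f.1) :
    (theta x y v f).1 = f.1.map (Equiv.swap x v) := by
  rw [theta_apply hx hv]; simp [thetaF, thetaS, h]

lemma mem_theta {x y v z : Fin n} (hx : y ≠ x) (hv : y ≠ v) (f : EdgeType n)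
    (h1 : z ≠ x) (h2 : z ≠ v) : z ∈ (theta x y v f).1 ↔ z ∈ f.1 := by
  by_cases h : y ∈ f.1
  · rw [theta_of_mem hx hv h]
  · rw [theta_val hx hv h, mem_map_swap, Equiv.swap_apply_of_ne_of_ne h1 h2]

lemma mem_theta_x {x y v : Fin n} (hx : y ≠ x) (hv : y ≠ v) {f : EdgeType n}
    (h : y ∉ f.1) : x ∈ (theta x y v f).1 ↔ v ∈ f.1 := by
  rw [theta_val hx hv h, mem_map_swap, Equiv.swap_apply_left]

lemma mem_theta_v {x y v : Fin n} (hx : y ≠ x) (hv : y ≠ v) {f : EdgeType n}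
    (h : y ∉ f.1) : v ∈ (theta x y v f).1 ↔ x ∈ f.1 := by
  rw [theta_val hx hv h, mem_map_swap, Equiv.swap_apply_right]

lemma theta_of_not_mem {x y v : Fin n} (hx : y ≠ x) (hv : y ≠ v) {f : EdgeType n}
    (h1 : x ∉ f.1) (h2 : v ∉ f.1) : theta x y v f = f := by
  by_cases h : y ∈ f.1
  · exact theta_of_mem hx hv h
  · apply Subtype.ext
    rw [theta_val hx hv h]
    refine (Sym2.map_congr (g := id) ?_).trans (by simp)
    intro a ha
    exact Equiv.swap_apply_of_ne_of_ne (by rintro rfl; exact h1 ha) (by rintro rfl; exact h2 ha)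

/-- The ordering with `x` and `v` exchanged. -/
noncomputable def act (σ : Ord n) (x y v : Fin n) : Ord n := σ.trans (theta x y v)

lemma pos_act (σ : Ord n) {x y v : Fin n} (hx : y ≠ x) (hv : y ≠ v) (f : EdgeType n) :
    pos (act σ x y v) f = pos σ (theta x y v f) := by
  have : (theta x y v).symm f = theta x y v f := by
    rw [Equiv.symm_apply_eq, theta_theta hx hv]
  simp [pos, act, this]

lemma act_act (σ : Ord n) {x y v : Fin n} (hx : y ≠ x) (hv : y ≠ v) :
    act (act σ x y v) x y v = σ := by
  ext i; simp [act, theta_theta hx hv]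

/-- `xy` is the first edge at `x` and comes before any edge at `v`. -/
def Adm (σ : Ord n) (x y v : Fin n) : Prop :=
  y ≠ x ∧ y ≠ v ∧ v ≠ x ∧ ∃ e : EdgeType n, e.1 = s(x, y) ∧
    (∀ f : EdgeType n, x ∈ f.1 → pos σ e ≤ pos σ f) ∧
    (∀ f : EdgeType n, v ∈ f.1 → pos σ e < pos σ f)

lemma edge_eq {e f : EdgeType n} {x y : Fin n} (hxy : y ≠ x) (he : e.1 = s(x, y)) (h1 : x ∈ f.1)
    (h2 : y ∈ f.1) : f = e := by
  apply Subtype.ext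
  rw [he]
  exact (Sym2.mem_and_mem_iff hxy.symm).1 ⟨h1, h2⟩

lemma adm_act {σ : Ord n} {x y v : Fin n} (h : Adm σ x y v) : Adm (act σ x y v) x y v := by
  obtain ⟨hx, hv, hvx, e, he, h1, h2⟩ := h
  have hye : y ∈ e.1 := by rw [he]; simp
  refine ⟨hx, hv, hvx, e, he, ?_, ?_⟩
  · intro f hf
    rw [pos_act σ hx hv, pos_act σ hx hv, theta_of_mem hx hv hye]
    by_cases hy : y ∈ f.1
    · rw [theta_of_mem hx hv hy]; exact h1 f hf
    · have : v ∈ (theta x y v f).1 := (mem_theta_v hx hv hy).2 hf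
      exact (h2 _ this).le
  · intro f hf
    rw [pos_act σ hx hv, pos_act σ hx hv, theta_of_mem hx hv hye]
    by_cases hy : y ∈ f.1
    · rw [theta_of_mem hx hv hy]; exact h2 f hf
    · have h3 : x ∈ (theta x y v f).1 := (mem_theta_x hx hv hy).2 hf
      refine lt_of_le_of_ne (h1 _ h3) ?_
      intro h4
      have h5 := pos_inj σ h4
      have h6 : y ∈ (theta x y v f).1 := h5 ▸ hye
      rw [mem_theta hx hv f hx hv] at h6
      exact hy h6

lemma adm_unique {σ : Ord n} {x y y' v v' : Fin n} (h : Adm σ x y v) (h' : Adm σ x y' v') :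
    y = y' := by
  obtain ⟨hx, hv, hvx, e, he, h1, h2⟩ := h
  obtain ⟨hx', hv', hvx', e', he', h1', h2'⟩ := h'
  have hxe : x ∈ e.1 := by rw [he]; simp
  have hxe' : x ∈ e'.1 := by rw [he']; simp
  have : e = e' := pos_inj σ (le_antisymm (h1 _ hxe') (h1' _ hxe))
  subst this
  rw [he] at he'
  have h7 : y = y' ∨ x = y' ∧ y = x := by simpa using he'
  rcases h7 with h7 | h7
  · exact h7
  · exact absurd h7.2 hx

open scoped Classical in
noncomputable def swp (σ : Ord n) (x v : Fin n) : Ord n :=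
  if h : ∃ y, Adm σ x y v then act σ x h.choose v else σ

lemma swp_eq {σ : Ord n} {x y v : Fin n} (h : Adm σ x y v) : swp σ x v = act σ x y v := by
  have hh : ∃ y, Adm σ x y v := ⟨y, h⟩
  rw [swp, dif_pos hh, adm_unique hh.choose_spec h]

lemma swp_swp (x v : Fin n) (σ : Ord n) : swp (swp σ x v) x v = σ := by
  by_cases hh : ∃ y, Adm σ x y v
  · obtain ⟨y, h⟩ := hh
    rw [swp_eq h, swp_eq (adm_act h), act_act σ h.1 h.2.1]
  · have : swp σ x v = σ := by rw [swp, dif_neg hh]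
    rw [this, this]

noncomputable def swpE (x v : Fin n) : Equiv.Perm (Ord n) :=
  Function.Involutive.toPerm (fun σ => swp σ x v) (swp_swp x v)

lemma iso_act {σ : Ord n} {x y v z : Fin n} (hx : y ≠ x) (hv : y ≠ v) (t : ℕ)
    (h1 : z ≠ x) (h2 : z ≠ v) : iso (act σ x y v) t z ↔ iso σ t z := by
  constructor
  · intro h f hf
    have := h (theta x y v f) ((mem_theta hx hv f h1 h2).2 hf)
    rwa [pos_act σ hx hv, theta_theta hx hv] at this
  · intro h f hf
    rw [pos_act σ hx hv]
    exact h _ ((mem_theta hx hv f h1 h2).2 hf)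

lemma iso_act_sub {σ : Ord n} {x y v z : Fin n} (h : Adm σ x y v) (t : ℕ)
    (hz : iso (act σ x y v) t z) : z = v ∨ iso σ t z := by
  by_cases h2 : z = v
  · exact Or.inl h2
  right
  have hx := h.1
  have hv := h.2.1
  by_cases h1 : z = x
  · subst h1
    obtain ⟨-, -, hvx, e, he, h3, h4⟩ := h
    intro f hf
    have h5 := hz e (by rw [he]; simp)
    rw [pos_act σ hx hv, theta_of_mem hx hv (by rw [he]; simp)] at h5
    exact h5.trans (h3 f hf)
  · exact (iso_act hx hv t h1 h2).1 hz

open scoped Classical in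
noncomputable def isoS (σ : Ord n) (t : ℕ) : Finset (Fin n) := univ.filter (iso σ t)

lemma mem_isoS {σ : Ord n} {t : ℕ} {z : Fin n} : z ∈ isoS σ t ↔ iso σ t z := by
  classical simp [isoS]

def Lp (k : ℕ) (σ : Ord n) (z : Fin n) : Prop := ∃ t, (isoS σ t).card ≤ k ∧ iso σ t z

open scoped Classical in
lemma card_Lp (k : ℕ) (σ : Ord n) : (univ.filter (Lp k σ)).card ≤ k := by
  by_cases h : ∃ t, (isoS σ t).card ≤ k
  · refine le_trans (card_le_card ?_) (Nat.find_spec h)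
    intro z hz
    obtain ⟨t, ht, hz⟩ := (mem_filter.1 hz).2
    exact mem_isoS.2 (iso_anti σ (Nat.find_min' h ht) hz)
  · have : univ.filter (Lp k σ) = ∅ := by
      apply filter_eq_empty_iff.2
      rintro z - ⟨t, ht, -⟩
      exact h ⟨t, ht⟩
    simp [this]

/-- The main configuration. -/
def PP (r : ℕ) (σ : Ord n) (x v : Fin n) : Prop :=
  ∃ y, Adm σ x y v ∧ ∃ t, (isoS σ t).card ≤ r ∧
    (∀ f g : EdgeType n, x ∈ f.1 → x ∈ g.1 → f ≠ g → pos σ f < t → t ≤ pos σ g) ∧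
    (∀ f : EdgeType n, v ∈ f.1 → y ∈ f.1 → t ≤ pos σ f)

lemma PP_Lp {r : ℕ} {σ : Ord n} {x v : Fin n} (h : PP r σ x v) : Lp (r + 1) (swp σ x v) v := by
  classical
  obtain ⟨y, ha, t, ht, hs, hvy⟩ := h
  rw [swp_eq ha]
  refine ⟨t, ?_, ?_⟩
  · have : isoS (act σ x y v) t ⊆ insert v (isoS σ t) := by
      intro z hz
      rcases iso_act_sub ha t (mem_isoS.1 hz) with h | h
      · simp [h]
      · exact mem_insert_of_mem (mem_isoS.2 h)
    exact (card_le_card this).trans ((card_insert_le _ _).trans (by omega))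
  · obtain ⟨hx, hv, hvx, e, he, h1, h2⟩ := ha
    intro f hf
    rw [pos_act σ hx hv]
    by_cases hy : y ∈ f.1
    · rw [theta_of_mem hx hv hy]; exact hvy f hf hy
    · have h3 : x ∈ (theta x y v f).1 := (mem_theta_x hx hv hy).2 hf
      by_contra hlt
      push Not at hlt
      have h4 : e ≠ theta x y v f := by
        intro h4
        have : y ∈ (theta x y v f).1 := by rw [← h4, he]; simp
        rw [mem_theta hx hv f hx hv] at this
        exact hy this
      have := hs e _ (by rw [he]; simp) h3 h4 (lt_of_le_of_lt (h1 _ h3) hlt)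
      omega

lemma theta_pair {x y v z w : Fin n} (hx : y ≠ x) (hv : y ≠ v) {f : EdgeType n}
    (h1 : z ≠ x) (h2 : z ≠ v) (h3 : z ≠ y) (hf : f.1 = s(z, w)) :
    (theta x y v f).1 = s(z, Equiv.swap x v w) := by
  by_cases h : y ∈ f.1
  · rw [theta_of_mem hx hv h, hf]
    have : w = y := by rw [hf] at h; simp at h; tauto
    subst this
    rw [Equiv.swap_apply_of_ne_of_ne hx hv]
  · rw [theta_val hx hv h, hf, Sym2.map_mk]
    simp [Equiv.swap_apply_of_ne_of_ne h1 h2]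

lemma PP_step {σ : Ord n} {x y v x' v' : Fin n} (ha : Adm σ x y v) (h : PP 0 σ x' v')
    (h1 : x' ≠ x) (h2 : x' ≠ v) (h3 : x' ≠ y) (h4 : v' ≠ x) (h5 : v' ≠ v) (h6 : v' ≠ y) :
    PP 1 (act σ x y v) x' v' := by
  classical
  obtain ⟨y', ⟨hx', hv', hvx', e', he', a1, a2⟩, t, ht, hs, hvy⟩ := h
  have hx := ha.1
  have hv := ha.2.1
  have tt := theta_theta (n := n) hx hv
  refine ⟨Equiv.swap x v y', ⟨?_, ?_, hvx', theta x y v e', theta_pair hx hv h1 h2 h3 he', ?_, ?_⟩,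
    t, ?_, ?_, ?_⟩
  · intro h
    apply hx'
    rw [Equiv.swap_apply_eq_iff, Equiv.swap_apply_of_ne_of_ne h1 h2] at h
    exact h
  · intro h
    apply hv'
    rw [Equiv.swap_apply_eq_iff, Equiv.swap_apply_of_ne_of_ne h4 h5] at h
    exact h
  · intro f hf
    rw [pos_act σ hx hv, pos_act σ hx hv, tt]
    exact a1 _ ((mem_theta hx hv f h1 h2).2 hf)
  · intro f hf
    rw [pos_act σ hx hv, pos_act σ hx hv, tt]
    exact a2 _ ((mem_theta hx hv f h4 h5).2 hf)
  · have : isoS (act σ x y v) t ⊆ insert v (isoS σ t) := by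
      intro z hz
      rcases iso_act_sub ha t (mem_isoS.1 hz) with h | h
      · simp [h]
      · exact mem_insert_of_mem (mem_isoS.2 h)
    exact (card_le_card this).trans ((card_insert_le _ _).trans (by omega))
  · intro f g hf hg hfg hft
    rw [pos_act σ hx hv] at hft ⊢
    exact hs _ _ ((mem_theta hx hv f h1 h2).2 hf) ((mem_theta hx hv g h1 h2).2 hg)
      (fun h => hfg ((theta x y v).injective h)) hft
  · intro f hf hyf
    rw [pos_act σ hx hv]
    have hne : v' ≠ Equiv.swap x v y' := by
      intro h
      apply hv'
      rw [eq_comm, Equiv.swap_apply_eq_iff, Equiv.swap_apply_of_ne_of_ne h4 h5] at h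
      exact h
    have hf' : f.1 = s(v', Equiv.swap x v y') := (Sym2.mem_and_mem_iff hne).1 ⟨hf, hyf⟩
    have := theta_pair hx hv h4 h5 h6 hf'
    rw [Equiv.swap_apply_self] at this
    apply hvy
    · rw [this]; simp
    · rw [this]; simp

end RGP
namespace RGP

variable {n : ℕ}

open scoped Classical in
noncomputable def W (r : ℕ) (σ : Ord n) : ℕ :=
  (univ.filter (fun p : Fin n × Fin n => PP r σ p.1 p.2)).card

open scoped Classical in
lemma W_eq (r : ℕ) (σ : Ord n) :
    W r σ = ∑ p : Fin n × Fin n, if PP r σ p.1 p.2 then 1 else 0 := by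
  simp [W]

open scoped Classical in
lemma sum_Lp (k : ℕ) (σ : Ord n) :
    (∑ p : Fin n × Fin n, if Lp k σ p.2 then 1 else 0) ≤ n * k := by
  rw [Fintype.sum_prod_type]
  calc ∑ x : Fin n, ∑ v : Fin n, (if Lp k σ v then 1 else 0) ≤ ∑ x : Fin n, k := by
        apply sum_le_sum
        intro x _
        have := card_Lp k σ
        simpa using this
    _ = n * k := by simp

open scoped Classical in
lemma sum_W (r : ℕ) : ∑ σ : Ord n, W r σ ≤ n * (r + 1) * Fintype.card (Ord n) := by
  calc ∑ σ : Ord n, W r σ = ∑ p : Fin n × Fin n, ∑ σ : Ord n, if PP r σ p.1 p.2 then 1 else 0 := by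
        simp_rw [W_eq]; exact sum_comm
    _ ≤ ∑ p : Fin n × Fin n, ∑ σ : Ord n, if Lp (r + 1) (swpE p.1 p.2 σ) p.2 then 1 else 0 := by
        apply sum_le_sum; intro p _
        apply sum_le_sum; intro σ _
        by_cases h : PP r σ p.1 p.2
        · have h2 : Lp (r + 1) (swpE p.1 p.2 σ) p.2 := PP_Lp h
          rw [if_pos h, if_pos h2]
        · rw [if_neg h]; exact Nat.zero_le _
    _ = ∑ p : Fin n × Fin n, ∑ σ : Ord n, if Lp (r + 1) σ p.2 then 1 else 0 := by
        apply sum_congr rfl; intro p _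
        exact Equiv.sum_comp (swpE p.1 p.2) (fun σ => if Lp (r + 1) σ p.2 then 1 else 0)
    _ = ∑ σ : Ord n, ∑ p : Fin n × Fin n, if Lp (r + 1) σ p.2 then 1 else 0 := sum_comm
    _ ≤ ∑ σ : Ord n, n * (r + 1) := sum_le_sum (fun σ _ => sum_Lp _ σ)
    _ = _ := by rw [sum_const, smul_eq_mul, mul_comm, card_univ]

open scoped Classical in
lemma W_step {σ : Ord n} {x v : Fin n} (h : PP 0 σ x v) : W 0 σ ≤ 6 * n + W 1 (swp σ x v) := by
  obtain ⟨y, ha, -⟩ := h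
  rw [swp_eq ha]
  set C : Finset (Fin n) := {x, v, y} with hC
  have hcard : C.card ≤ 3 := card_le_three
  have hsub : univ.filter (fun p : Fin n × Fin n => PP 0 σ p.1 p.2) ⊆
      (C ×ˢ univ ∪ univ ×ˢ C) ∪
        univ.filter (fun p : Fin n × Fin n => PP 1 (act σ x y v) p.1 p.2) := by
    rintro ⟨a, b⟩ hp
    have hp := (mem_filter.1 hp).2
    by_cases h1 : a ∈ C
    · simp [h1]
    by_cases h2 : b ∈ C
    · simp [h2]
    · apply mem_union_right
      simp only [hC, mem_insert, mem_singleton, not_or] at h1 h2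
      simp only [mem_filter, mem_univ, true_and]
      exact PP_step ha hp h1.1 h1.2.1 h1.2.2 h2.1 h2.2.1 h2.2.2
  refine (card_le_card hsub).trans ((card_union_le _ _).trans ?_)
  have h1 := card_union_le (C ×ˢ (univ : Finset (Fin n))) ((univ : Finset (Fin n)) ×ˢ C)
  rw [card_product, card_product, card_univ, Fintype.card_fin] at h1
  have h2 : C.card * n ≤ 3 * n := Nat.mul_le_mul_right _ hcard
  have h3 : n * C.card ≤ n * 3 := Nat.mul_le_mul_left _ hcard
  unfold W
  omega

open scoped Classical in
lemma sum_W_sq : ∑ σ : Ord n, W 0 σ ^ 2 ≤ 8 * n ^ 2 * Fintype.card (Ord n) := by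
  calc ∑ σ : Ord n, W 0 σ ^ 2
      = ∑ σ : Ord n, ∑ p : Fin n × Fin n, (if PP 0 σ p.1 p.2 then 1 else 0) * W 0 σ := by
        apply sum_congr rfl; intro σ _
        rw [← sum_mul, ← W_eq, sq]
    _ ≤ ∑ σ : Ord n, ∑ p : Fin n × Fin n, ((if PP 0 σ p.1 p.2 then 1 else 0) * (6 * n) +
          (if Lp 1 (swpE p.1 p.2 σ) p.2 then 1 else 0) * W 1 (swpE p.1 p.2 σ)) := by
        apply sum_le_sum; intro σ _
        apply sum_le_sum; intro p _
        by_cases h : PP 0 σ p.1 p.2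
        · have h2 : Lp 1 (swpE p.1 p.2 σ) p.2 := PP_Lp h
          rw [if_pos h, if_pos h2, one_mul, one_mul, one_mul]
          exact W_step h
        · rw [if_neg h, zero_mul]; exact Nat.zero_le _
    _ = (∑ σ : Ord n, W 0 σ) * (6 * n) + ∑ p : Fin n × Fin n, ∑ σ : Ord n,
          (if Lp 1 (swpE p.1 p.2 σ) p.2 then 1 else 0) * W 1 (swpE p.1 p.2 σ) := by
        simp_rw [sum_add_distrib]
        congr 1
        · rw [sum_mul]
          apply sum_congr rfl; intro σ _
          rw [W_eq, sum_mul]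
        · exact sum_comm
    _ = (∑ σ : Ord n, W 0 σ) * (6 * n) + ∑ p : Fin n × Fin n, ∑ σ : Ord n,
          (if Lp 1 σ p.2 then 1 else 0) * W 1 σ := by
        congr 1
        apply sum_congr rfl; intro p _
        exact Equiv.sum_comp (swpE p.1 p.2) (fun σ => (if Lp 1 σ p.2 then 1 else 0) * W 1 σ)
    _ = (∑ σ : Ord n, W 0 σ) * (6 * n) + ∑ σ : Ord n,
          (∑ p : Fin n × Fin n, (if Lp 1 σ p.2 then 1 else 0)) * W 1 σ := by
        congr 1
        rw [sum_comm]
        apply sum_congr rfl; intro σ _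
        rw [sum_mul]
    _ ≤ (n * (0 + 1) * Fintype.card (Ord n)) * (6 * n) + ∑ σ : Ord n, (n * 1) * W 1 σ := by
        gcongr with σ _
        · exact sum_W 0
        · exact sum_Lp 1 σ
    _ ≤ (n * (0 + 1) * Fintype.card (Ord n)) * (6 * n) +
          (n * 1) * (n * (1 + 1) * Fintype.card (Ord n)) := by
        rw [← mul_sum]
        gcongr
        exact sum_W 1
    _ = _ := by ring

open scoped Classical in
/-- Edges sharing a vertex with `e`. -/
noncomputable def SS (e : EdgeType n) : Finset (EdgeType n) :=
  univ.filter (fun f => ∃ z, z ∈ e.1 ∧ z ∈ f.1)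

lemma mem_SS {e f : EdgeType n} : f ∈ SS e ↔ ∃ z, z ∈ e.1 ∧ z ∈ f.1 := by
  classical simp [SS]

lemma self_mem_SS (e : EdgeType n) : e ∈ SS e := by
  rw [mem_SS]
  obtain ⟨e, he⟩ := e
  induction e with
  | _ a b => exact ⟨a, by simp, by simp⟩

open scoped Classical in
lemma card_star (a : Fin n) : n - 1 ≤ (univ.filter (fun f : EdgeType n => a ∈ f.1)).card := by
  have h : (univ.erase a : Finset (Fin n)).card = n - 1 := by simp
  rw [← h]
  have hinj : Function.Injective (fun z : Fin n => s(a, z)) := by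
    intro z w hzw
    have hzw' : z = w ∨ a = w ∧ z = a := by simpa using hzw
    rcases hzw' with h | h
    · exact h
    · exact h.2.trans h.1
  rw [← card_image_of_injective _ hinj]
  refine le_trans (card_le_card ?_)
    (card_image_le (s := univ.filter (fun f : EdgeType n => a ∈ f.1)) (f := Subtype.val))
  intro f hf
  obtain ⟨z, hz, rfl⟩ := mem_image.1 hf
  have hz' : a ≠ z := (ne_of_mem_erase hz).symm
  exact mem_image.2 ⟨⟨s(a, z), by simpa using hz'⟩, by simp, rfl⟩

lemma card_SS (e : EdgeType n) : 2 * n - 3 ≤ (SS e).card := by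
  classical
  obtain ⟨e, he⟩ := e
  induction e with
  | _ a b =>
    have hab : a ≠ b := by simpa using he
    have h1 := card_star a
    have h2 := card_star b
    have h3 : ((univ.filter (fun f : EdgeType n => a ∈ f.1)) ∩
        (univ.filter (fun f : EdgeType n => b ∈ f.1))).card ≤ 1 := by
      rw [card_le_one]
      intro f hf g hg
      simp only [mem_inter, mem_filter, mem_univ, true_and] at hf hg
      apply Subtype.ext
      rw [(Sym2.mem_and_mem_iff hab).1 hf, (Sym2.mem_and_mem_iff hab).1 hg]
    have h4 := card_union_add_card_inter (univ.filter (fun f : EdgeType n => a ∈ f.1))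
      (univ.filter (fun f : EdgeType n => b ∈ f.1))
    have h5 : (univ.filter (fun f : EdgeType n => a ∈ f.1)) ∪
        (univ.filter (fun f : EdgeType n => b ∈ f.1)) ⊆ SS ⟨s(a, b), he⟩ := by
      intro f hf
      rw [mem_SS]
      simp only [mem_union, mem_filter, mem_univ, true_and] at hf
      rcases hf with hf | hf
      · exact ⟨a, by simp, hf⟩
      · exact ⟨b, by simp, hf⟩
    have h6 := card_le_card h5
    omega

/-- `e` is the first edge at both its ends. -/
def Dp (σ : Ord n) (e : EdgeType n) : Prop := ∀ f ∈ SS e, pos σ e ≤ pos σ f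

lemma pos_swap (σ : Ord n) (e f g : EdgeType n) :
    pos (σ.trans (Equiv.swap e f)) g = pos σ (Equiv.swap e f g) := by
  simp [pos]

lemma swap_mem_SS {e f g : EdgeType n} (hf : f ∈ SS e) (hg : g ∈ SS e) :
    Equiv.swap e f g ∈ SS e := by
  rw [Equiv.swap_apply_def]
  split_ifs
  · exact hf
  · exact self_mem_SS e
  · exact hg

open scoped Classical in
lemma card_D (e : EdgeType n) (Q : Ord n → Prop)
    (hQ : ∀ σ f, Dp σ e → Q σ → f ∈ SS e → Q (σ.trans (Equiv.swap e f))) :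
    (univ.filter (fun σ => Dp σ e ∧ Q σ)).card * (2 * n - 3) ≤ (univ.filter Q).card := by
  refine (Nat.mul_le_mul_left _ (card_SS e)).trans ?_
  rw [← card_product]
  apply card_le_card_of_injOn (fun p => p.1.trans (Equiv.swap e p.2))
  · rintro ⟨σ, f⟩ hp
    simp only [coe_product, Set.mem_prod, mem_coe, mem_filter, mem_univ, true_and] at hp
    simp only [coe_filter, mem_univ, true_and, Set.mem_ofPred_eq]
    exact hQ σ f hp.1.1 hp.1.2 hp.2
  · rintro ⟨σ, f⟩ hp ⟨σ', f'⟩ hp' h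
    simp only [coe_product, Set.mem_prod, mem_coe, mem_filter, mem_univ, true_and] at hp hp' h
    have key : ∀ (σ : Ord n) (f : EdgeType n), Dp σ e → f ∈ SS e → ∀ g ∈ SS e,
        pos (σ.trans (Equiv.swap e f)) f ≤ pos (σ.trans (Equiv.swap e f)) g := by
      intro σ f hD hf g hg
      rw [pos_swap, pos_swap, Equiv.swap_apply_right]
      exact hD _ (swap_mem_SS hf hg)
    have k1 := key σ f hp.1.1 hp.2 f' hp'.2
    have k2 := key σ' f' hp'.1.1 hp'.2 f hp.2
    rw [← h] at k2
    have hff := pos_inj _ (le_antisymm k1 k2)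
    subst hff
    have : σ = σ' := by
      apply Equiv.ext
      intro i
      have := congrArg (fun τ : Ord n => Equiv.swap e f (τ i)) h
      simpa using this
    rw [this]

open scoped Classical in
lemma sum_D : (∑ σ : Ord n, (univ.filter (Dp σ)).card) * (2 * n - 3) ≤
    Fintype.card (EdgeType n) * Fintype.card (Ord n) := by
  have h1 : ∑ σ : Ord n, (univ.filter (Dp σ)).card =
      ∑ e : EdgeType n, (univ.filter (fun σ : Ord n => Dp σ e ∧ True)).card := by
    simp only [card_filter, and_true]
    exact sum_comm
  rw [h1, sum_mul]
  calc _ ≤ ∑ e : EdgeType n, (univ.filter (fun σ : Ord n => True)).card :=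
        by
        apply sum_le_sum; intro e _
        have h2 := card_D e (fun _ => True) (fun _ _ _ _ _ => trivial)
        refine le_trans (le_of_eq ?_) (h2.trans ?_)
        · congr!
        · simp
    _ = _ := by simp

def QA (e : EdgeType n) (σ : Ord n) : Prop := ∃ t, ∀ z, iso σ t z ↔ z ∈ e.1

lemma QA_unique {σ : Ord n} {e f : EdgeType n} (he : QA e σ) (hf : QA f σ) : e = f := by
  have key : ∀ (e f : EdgeType n), (∀ z, z ∈ e.1 → z ∈ f.1) → e = f := by
    rintro ⟨e, he⟩ f h
    induction e with
    | _ a b =>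
      have hab : a ≠ b := by simpa using he
      exact Subtype.ext ((Sym2.mem_and_mem_iff hab).1 ⟨h a (by simp), h b (by simp)⟩).symm
  obtain ⟨t, ht⟩ := he
  obtain ⟨s, hs⟩ := hf
  rcases le_total s t with h | h
  · exact key e f (fun z hz => (hs z).1 (iso_anti σ h ((ht z).2 hz)))
  · exact (key f e (fun z hz => (ht z).1 (iso_anti σ h ((hs z).2 hz)))).symm

lemma QA_swap (e : EdgeType n) (σ : Ord n) (f : EdgeType n) (hD : Dp σ e) (hQ : QA e σ)
    (hf : f ∈ SS e) : QA e (σ.trans (Equiv.swap e f)) := by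
  obtain ⟨t, ht⟩ := hQ
  obtain ⟨w, hw, hwf⟩ := mem_SS.1 hf
  have h1 : t ≤ pos σ e := (ht w).2 hw e hw
  have h2 : t ≤ pos σ f := h1.trans (hD f hf)
  refine ⟨t, fun z => (Iff.trans ?_ (ht z))⟩
  have : ∀ g, t ≤ pos (σ.trans (Equiv.swap e f)) g ↔ t ≤ pos σ g := by
    intro g
    rw [pos_swap, Equiv.swap_apply_def]
    split_ifs with h h
    · subst h; simp [h1, h2]
    · subst h; simp [h1, h2]
    · rfl
  simp only [iso, this]

open scoped Classical in
lemma card_A : (univ.filter (fun σ : Ord n => ∃ e, Dp σ e ∧ QA e σ)).card * (2 * n - 3) ≤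
    Fintype.card (Ord n) := by
  have h1 : (univ.filter (fun σ : Ord n => ∃ e, Dp σ e ∧ QA e σ)).card ≤
      ∑ e : EdgeType n, (univ.filter (fun σ : Ord n => Dp σ e ∧ QA e σ)).card := by
    refine le_trans (card_le_card ?_) card_biUnion_le
    intro σ hσ
    simpa using hσ
  refine (Nat.mul_le_mul_right _ h1).trans ?_
  rw [sum_mul]
  calc _ ≤ ∑ e : EdgeType n, (univ.filter (QA e)).card :=
        sum_le_sum (fun e _ => card_D e _ (QA_swap e))
    _ = ∑ σ : Ord n, (univ.filter (fun e => QA e σ)).card := by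
        simp only [card_filter]; exact sum_comm
    _ ≤ ∑ σ : Ord n, 1 := by
        apply sum_le_sum; intro σ _
        rw [card_le_one]
        intro e he f hf
        exact QA_unique (mem_filter.1 he).2 (mem_filter.1 hf).2
    _ = _ := by simp

end RGP
namespace RGP

variable {n : ℕ}

lemma mem_procEdges {σ : Ord n} {m : ℕ} {f : Sym2 (Fin n)} :
    f ∈ procEdges σ m ↔ ∃ e : EdgeType n, e.1 = f ∧ pos σ e < m := by
  simp only [procEdges, mem_image, mem_filter, mem_univ, true_and]
  constructor
  · rintro ⟨i, hi, rfl⟩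
    exact ⟨σ i, rfl, by simpa [pos] using hi⟩
  · rintro ⟨e, rfl, he⟩
    exact ⟨σ.symm e, he, by simp⟩

lemma one_le_deg {σ : Ord n} {m : ℕ} {v : Fin n} :
    1 ≤ deg (procEdges σ m) v ↔ ¬ iso σ m v := by
  rw [deg, Nat.one_le_iff_ne_zero, ← Nat.pos_iff_ne_zero, card_pos]
  constructor
  · rintro ⟨f, hf⟩ h
    obtain ⟨hf, hv⟩ := mem_filter.1 hf
    obtain ⟨e, rfl, he⟩ := mem_procEdges.1 hf
    have := h e hv
    omega
  · intro h
    unfold iso at h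
    push Not at h
    obtain ⟨e, he, hp⟩ := h
    exact ⟨e.1, mem_filter.2 ⟨mem_procEdges.2 ⟨e, rfl, hp⟩, he⟩⟩

lemma exists_edge (hn : 2 ≤ n) (x : Fin n) : ∃ e : EdgeType n, x ∈ e.1 := by
  have : Nontrivial (Fin n) := Fin.nontrivial_iff_two_le.2 hn
  obtain ⟨y, hy⟩ := exists_ne x
  exact ⟨⟨s(x, y), by simpa using hy.symm⟩, by simp⟩

lemma pos_lt (σ : Ord n) (e : EdgeType n) : pos σ e < numEdges n := (σ.symm e).2

lemma tau_spec (hn : 2 ≤ n) (σ : Ord n) (z : Fin n) : ¬ iso σ (tau 1 σ) z := by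
  have : tau 1 σ ∈ {m | ∀ v : Fin n, 1 ≤ deg (procEdges σ m) v} := by
    apply Nat.sInf_mem
    refine ⟨numEdges n, fun v => ?_⟩
    rw [one_le_deg]
    intro h
    obtain ⟨e, he⟩ := exists_edge hn v
    have := h e he
    have := pos_lt σ e
    omega
  exact one_le_deg.1 (this z)

lemma tau_le {σ : Ord n} {m : ℕ} (h : ∀ z, ¬ iso σ m z) : tau 1 σ ≤ m :=
  Nat.sInf_le (fun v => one_le_deg.2 (h v))

lemma mem_buy {st : Strategy n} {σ : Ord n} {m : ℕ} {e : EdgeType n} :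
    e.1 ∈ buy st σ m ↔ pos σ e < m ∧ st (prefixList σ (pos σ e + 1)) = true := by
  induction m with
  | zero => simp [buy]
  | succ i ih =>
    rw [buy]
    by_cases hpe : pos σ e = i
    · have hi : i < numEdges n := hpe ▸ pos_lt σ e
      have hσ : σ ⟨i, hi⟩ = e := by
        rw [← Equiv.eq_symm_apply]; exact Fin.ext hpe.symm
      rw [dif_pos hi, hσ, hpe]
      by_cases hs : st (prefixList σ (i + 1)) = true
      · simp [hs]
      · have h2 : e.1 ∉ buy st σ i := fun h => by have := (ih.1 h).1; omega
        simp [hs, h2]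
    · have h1 : pos σ e < i + 1 ↔ pos σ e < i := by omega
      rw [h1, ← ih]
      split_ifs with hi hs
      · rw [mem_insert]
        constructor
        · rintro (h | h)
          · exfalso
            apply hpe
            have : e = σ ⟨i, hi⟩ := Subtype.ext h
            rw [this]; simp [pos]
          · exact h
        · exact Or.inr
      · rfl
      · rfl

lemma buy_sub {st : Strategy n} {σ : Ord n} {m : ℕ} {f : Sym2 (Fin n)} (h : f ∈ buy st σ m) :
    ∃ e : EdgeType n, e.1 = f := by
  induction m with
  | zero => simp [buy] at h
  | succ i ih =>
    rw [buy] at h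
    split_ifs at h with hi hs
    · rcases mem_insert.1 h with h | h
      · exact ⟨_, h.symm⟩
      · exact ih h
    · exact ih h
    · exact ih h

def Fail (st : Strategy n) (σ : Ord n) : Prop := ∃ v : Fin n, deg (buy st σ (tau 1 σ)) v = 0

lemma fail_of {st : Strategy n} {σ : Ord n} (v : Fin n)
    (h : ∀ e : EdgeType n, v ∈ e.1 → pos σ e < tau 1 σ → e.1 ∉ buy st σ (tau 1 σ)) :
    Fail st σ := by
  refine ⟨v, ?_⟩
  rw [deg, card_eq_zero, filter_eq_empty_iff]
  intro f hf hv
  obtain ⟨e, rfl⟩ := buy_sub hf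
  exact h e hv (mem_buy.1 hf).1 hf

def First (σ : Ord n) (x : Fin n) (e : EdgeType n) : Prop :=
  x ∈ e.1 ∧ ∀ f : EdgeType n, x ∈ f.1 → pos σ e ≤ pos σ f

lemma exists_first (hn : 2 ≤ n) (σ : Ord n) (x : Fin n) : ∃ e, First σ x e := by
  classical
  obtain ⟨e0, he0⟩ := exists_edge hn x
  obtain ⟨e, he, h⟩ := exists_min_image (univ.filter (fun e : EdgeType n => x ∈ e.1)) (pos σ)
    ⟨e0, by simpa using he0⟩
  exact ⟨e, (mem_filter.1 he).2, fun f hf => h f (by simpa using hf)⟩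

lemma first_unique {σ : Ord n} {x : Fin n} {e f : EdgeType n} (he : First σ x e)
    (hf : First σ x f) : e = f :=
  pos_inj σ (le_antisymm (he.2 f hf.1) (hf.2 e he.1))

def XX (st : Strategy n) (σ : Ord n) (x : Fin n) : Prop :=
  ∀ e, First σ x e → e.1 ∉ buy st σ (tau 1 σ)

open scoped Classical in
lemma card_XX (hn : 2 ≤ n) (st : Strategy n) (σ : Ord n) :
    n ≤ (univ.filter (XX st σ)).card + (buy st σ (tau 1 σ)).card + (univ.filter (Dp σ)).card := by
  choose F hF using exists_first hn σ
  set Y := univ.filter (fun x => ¬ XX st σ x) with hY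
  set B := buy st σ (tau 1 σ) with hB
  have h0 : (univ.filter (XX st σ)).card + Y.card = n := by
    rw [hY, card_filter_add_card_filter_not, card_univ, Fintype.card_fin]
  have hmaps : ∀ x ∈ Y, (F x).1 ∈ B := by
    intro x hx
    have hx := (mem_filter.1 hx).2
    unfold XX at hx
    push Not at hx
    obtain ⟨e, he, heb⟩ := hx
    rw [first_unique (hF x) he]; exact heb
  have h1 : Y.card = ∑ b ∈ B, (Y.filter (fun x => (F x).1 = b)).card :=
    card_eq_sum_card_fiberwise hmaps
  have h2 : ∀ b ∈ B, (Y.filter (fun x => (F x).1 = b)).card ≤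
      1 + if ∃ e : EdgeType n, e.1 = b ∧ Dp σ e then 1 else 0 := by
    intro b hb
    by_cases hc : (Y.filter (fun x => (F x).1 = b)).card ≤ 1
    · omega
    push Not at hc
    obtain ⟨x, hx, y, hy, hxy⟩ := one_lt_card.1 hc
    have hx := (mem_filter.1 hx).2
    have hy := (mem_filter.1 hy).2
    have hb2 : b = s(x, y) := by
      apply (Sym2.mem_and_mem_iff hxy).1
      exact ⟨hx ▸ (hF x).1, hy ▸ (hF y).1⟩
    have hFF : F x = F y := Subtype.ext (hx.trans hy.symm)
    have hD : Dp σ (F x) := by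
      intro f hf
      obtain ⟨z, hz, hzf⟩ := mem_SS.1 hf
      rw [hx, hb2, Sym2.mem_iff] at hz
      rcases hz with rfl | rfl
      · exact (hF z).2 f hzf
      · rw [hFF]; exact (hF z).2 f hzf
    rw [if_pos ⟨F x, hx, hD⟩]
    have : Y.filter (fun x => (F x).1 = b) ⊆ {x, y} := by
      intro z hz
      have hz := (mem_filter.1 hz).2
      have : z ∈ b := hz ▸ (hF z).1
      rw [hb2, Sym2.mem_iff] at this
      simpa using this
    exact (card_le_card this).trans card_le_two
  have h3 : Y.card ≤ B.card + (univ.filter (Dp σ)).card := by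
    rw [h1]
    refine (sum_le_sum h2).trans ?_
    rw [sum_add_distrib, sum_const, smul_eq_mul, mul_one, ← card_filter]
    gcongr
    refine le_trans (card_le_card ?_) (card_image_le (s := univ.filter (Dp σ)) (f := Subtype.val))
    intro b hb
    obtain ⟨e, rfl, he⟩ := (mem_filter.1 hb).2
    exact mem_image.2 ⟨e, by simpa using he, rfl⟩
  omega

lemma prefix_congr {σ σ' : Ord n} {i : ℕ}
    (h : ∀ j : Fin (numEdges n), (j : ℕ) < i → σ' j = σ j) : prefixList σ' i = prefixList σ i := by
  unfold prefixList
  apply List.filterMap_congr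
  intro j hj
  rw [List.mem_range] at hj
  by_cases hjn : j < numEdges n
  · rw [dif_pos hjn, dif_pos hjn, h ⟨j, hjn⟩ hj]
  · rw [dif_neg hjn, dif_neg hjn]

open scoped Classical in
lemma main_step (hn : 2 ≤ n) (st : Strategy n) (σ : Ord n) (hF : ¬ Fail st σ)
    (hA : ¬ ∃ e, Dp σ e ∧ QA e σ) :
    (univ.filter (XX st σ)).card ≤ 1 + (univ.filter (fun p : Fin n × Fin n =>
      PP 0 (swp σ p.1 p.2) p.1 p.2 ∧ Fail st (swp σ p.1 p.2))).card := by
  obtain ⟨T, hT⟩ : ∃ T, T = tau 1 σ := ⟨_, rfl⟩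
  have hTs := tau_spec hn σ
  rw [← hT] at hTs
  have hT0 : 0 < T := by
    rcases Nat.eq_zero_or_pos T with h | h
    · exfalso
      apply hTs ⟨0, by omega⟩
      intro e _
      omega
    · exact h
  obtain ⟨v, hv⟩ : ∃ v, iso σ (T - 1) v := by
    by_contra h
    push Not at h
    have := tau_le h
    omega
  have hcov : ∀ z, iso σ (T - 1) z → ∃ g : EdgeType n, z ∈ g.1 ∧ pos σ g = T - 1 := by
    intro z hz
    have h1 := hTs z
    unfold iso at h1
    push Not at h1
    obtain ⟨g, hg, hgp⟩ := h1
    have := hz g hg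
    exact ⟨g, hg, by omega⟩
  obtain ⟨g, hvg, hgp⟩ := hcov v hv
  have hcov' : ∀ z, iso σ (T - 1) z → z ∈ g.1 := by
    intro z hz
    obtain ⟨g', h1, h2⟩ := hcov z hz
    rwa [pos_inj σ (h2.trans hgp.symm)] at h1
  obtain ⟨w, hw⟩ := Sym2.mem_iff_exists.1 hvg
  have hwn : ¬ iso σ (T - 1) w := by
    intro hwi
    apply hA
    have hall : ∀ z, iso σ (T - 1) z ↔ z ∈ g.1 := by
      intro z
      refine ⟨hcov' z, fun hz => ?_⟩
      rw [hw, Sym2.mem_iff] at hz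
      rcases hz with rfl | rfl
      · exact hv
      · exact hwi
    refine ⟨g, ?_, T - 1, hall⟩
    intro f hf
    obtain ⟨z, hz, hzf⟩ := mem_SS.1 hf
    rw [hgp]
    exact (hall z).2 hz f hzf
  have hiso : ∀ z, iso σ (T - 1) z → z = v := by
    intro z hz
    have h1 := hcov' z hz
    rw [hw, Sym2.mem_iff] at h1
    rcases h1 with h1 | h1
    · exact h1
    · subst h1; exact absurd hz hwn
  have key : ∀ x, XX st σ x → x ≠ w → PP 0 (swp σ x v) x v ∧ Fail st (swp σ x v) := by
    intro x hX hxw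
    obtain ⟨e, he⟩ := exists_first hn σ x
    have heb := hX e he
    rw [← hT] at heb
    have hpe : pos σ e < T := by
      have h1 := hTs x
      unfold iso at h1
      push Not at h1
      obtain ⟨f, hf, hfp⟩ := h1
      exact lt_of_le_of_lt (he.2 f hf) hfp
    have hpe1 : pos σ e < T - 1 := by
      by_contra hcon
      apply hF
      apply fail_of v
      intro f hf hfp
      rw [← hT] at hfp ⊢
      have h1 := hv f hf
      have : f = e := pos_inj σ (by omega)
      rw [this]; exact heb
    have hve : v ∉ e.1 := fun h => by have := hv e h; omega
    have hvx : v ≠ x := by rintro rfl; exact hve he.1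
    obtain ⟨y, hy⟩ := Sym2.mem_iff_exists.1 he.1
    have hyx : y ≠ x := by
      rintro rfl
      apply e.2; rw [hy]; simp
    have hyv : y ≠ v := by
      rintro rfl
      apply hve; rw [hy]; simp
    have hye : y ∈ e.1 := by rw [hy]; simp
    have ha : Adm σ x y v := ⟨hyx, hyv, hvx, e, hy, he.2, fun f hf => by
      have := hv f hf; omega⟩
    obtain ⟨f, hxf, hfe, hfp⟩ : ∃ f : EdgeType n, x ∈ f.1 ∧ f ≠ e ∧ pos σ f < T - 1 := by
      by_contra hcon
      push Not at hcon
      apply hF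
      apply fail_of x
      intro f hf hfp
      rw [← hT] at hfp ⊢
      by_cases hfe : f = e
      · rw [hfe]; exact heb
      · exfalso
        have h1 := hcon f hf hfe
        have h2 : f = g := pos_inj σ (by omega)
        rw [h2, hw, Sym2.mem_iff] at hf
        rcases hf with h | h
        · exact hvx h.symm
        · exact hxw h
    rw [swp_eq ha]
    have hpa := pos_act σ hyx hyv
    have hemp : ∀ z, ¬ iso (act σ x y v) (T - 1) z := by
      intro z hz
      have hzv : z = v := by
        rcases iso_act_sub ha _ hz with h | h
        · exact h
        · exact hiso z h
      subst hzv
      have hyf : y ∉ f.1 := fun h => hfe (edge_eq hyx hy hxf h)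
      have h1 := hz (theta x y z f) ((mem_theta_v hyx hyv hyf).2 hxf)
      rw [hpa, theta_theta hyx hyv] at h1
      omega
    have hsole : ∀ f : EdgeType n, x ∈ f.1 → pos (act σ x y v) f < T - 1 → f = e := by
      intro f hf hfp
      by_cases hyf : y ∈ f.1
      · exact edge_eq hyx hy hf hyf
      · exfalso
        rw [hpa] at hfp
        have := hv _ ((mem_theta_v hyx hyv hyf).2 hf)
        omega
    refine ⟨⟨y, adm_act ha, T - 1, ?_, ?_, ?_⟩, ?_⟩
    · rw [Nat.le_zero, card_eq_zero, eq_empty_iff_forall_notMem]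
      intro z hz
      exact hemp z (mem_isoS.1 hz)
    · intro f g hf hg hfg hfp
      by_contra hcon
      push Not at hcon
      exact hfg ((hsole f hf hfp).trans (hsole g hg hcon).symm)
    · intro f hf hyf
      rw [hpa, theta_of_mem hyx hyv hyf]
      exact hv f hf
    · have hle := tau_le hemp
      apply fail_of x
      intro f hf hfp hfb
      have hfe := hsole f hf (by omega)
      subst hfe
      have h1 := (mem_buy.1 hfb).2
      have hpf : pos (act σ x y v) f = pos σ f := by rw [hpa, theta_of_mem hyx hyv hye]
      rw [hpf, prefix_congr (σ := σ)] at h1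
      · exact heb (mem_buy.2 ⟨hpe, h1⟩)
      · intro j hj
        show theta x y v (σ j) = σ j
        have hpj : pos σ (σ j) = j := by simp [pos]
        have hvj : v ∉ (σ j).1 := fun h => by have := hv _ h; omega
        by_cases hxj : x ∈ (σ j).1
        · have h2 := he.2 _ hxj
          have h3 : σ j = f := pos_inj σ (by omega)
          rw [h3]; exact theta_of_mem hyx hyv hye
        · exact theta_of_not_mem hyx hyv hxj hvj
  have h1 : (univ.filter (XX st σ)).card ≤ 1 + ((univ.filter (XX st σ)).erase w).card := by
    have := pred_card_le_card_erase (s := univ.filter (XX st σ)) (a := w)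
    omega
  refine h1.trans (Nat.add_le_add_left ?_ 1)
  apply card_le_card_of_injOn (fun x => (x, v))
  · intro x hx
    have hx := mem_erase.1 (mem_coe.1 hx)
    rw [mem_coe, mem_filter]
    exact ⟨mem_univ _, key x (mem_filter.1 hx.2).2 hx.1⟩
  · intro a _ b _ hab
    exact congrArg Prod.fst hab

end RGP
namespace RGP

variable {n : ℕ}

lemma card_edges (n : ℕ) : Fintype.card (EdgeType n) = numEdges n := by
  rw [Sym2.card_subtype_not_diag, Fintype.card_fin, Nat.choose_two_right, numEdges]

lemma nonempty_ord (n : ℕ) : Nonempty (Ord n) := by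
  refine ⟨(Fintype.equivFinOfCardEq (card_edges n)).symm⟩

open scoped Classical in
lemma sum_K (st : Strategy n) :
    ∑ σ : Ord n, (univ.filter (fun p : Fin n × Fin n =>
      PP 0 (swp σ p.1 p.2) p.1 p.2 ∧ Fail st (swp σ p.1 p.2))).card =
    ∑ σ : Ord n, (if Fail st σ then 1 else 0) * W 0 σ := by
  calc _ = ∑ p : Fin n × Fin n, ∑ σ : Ord n,
        (if PP 0 (swpE p.1 p.2 σ) p.1 p.2 ∧ Fail st (swpE p.1 p.2 σ) then 1 else 0) := by
        simp only [card_filter]; exact sum_comm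
    _ = ∑ p : Fin n × Fin n, ∑ σ : Ord n, (if PP 0 σ p.1 p.2 ∧ Fail st σ then 1 else 0) := by
        apply sum_congr rfl; intro p _
        exact Equiv.sum_comp (swpE p.1 p.2)
          (fun σ => if PP 0 σ p.1 p.2 ∧ Fail st σ then 1 else 0)
    _ = ∑ σ : Ord n, ∑ p : Fin n × Fin n, (if PP 0 σ p.1 p.2 ∧ Fail st σ then 1 else 0) := sum_comm
    _ = _ := by
        apply sum_congr rfl; intro σ _
        rw [W_eq, mul_sum]
        apply sum_congr rfl; intro p _
        by_cases h1 : Fail st σ <;> by_cases h2 : PP 0 σ p.1 p.2 <;> simp [h1, h2]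

open scoped Classical in
lemma sum_XX (hn : 2 ≤ n) (st : Strategy n) :
    ∑ σ : Ord n, (univ.filter (XX st σ)).card ≤
      n * (univ.filter (Fail st)).card +
      n * (univ.filter (fun σ : Ord n => ∃ e, Dp σ e ∧ QA e σ)).card + Fintype.card (Ord n) +
      ∑ σ : Ord n, (if Fail st σ then 1 else 0) * W 0 σ := by
  rw [← sum_K]
  have h1 : ∀ σ : Ord n, (univ.filter (XX st σ)).card ≤ n * (if Fail st σ then 1 else 0) +
      n * (if ∃ e, Dp σ e ∧ QA e σ then 1 else 0) + 1 + (univ.filter (fun p : Fin n × Fin n =>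
      PP 0 (swp σ p.1 p.2) p.1 p.2 ∧ Fail st (swp σ p.1 p.2))).card := by
    intro σ
    have h0 : (univ.filter (XX st σ)).card ≤ n := by
      simpa using card_filter_le (univ : Finset (Fin n)) (XX st σ)
    by_cases hF : Fail st σ
    · rw [if_pos hF]; omega
    by_cases hA : ∃ e, Dp σ e ∧ QA e σ
    · rw [if_pos hA]; omega
    · have := main_step hn st σ hF hA
      omega
  refine (sum_le_sum (fun σ _ => h1 σ)).trans ?_
  simp only [sum_add_distrib, ← mul_sum, card_filter, sum_const, card_univ, smul_eq_mul, mul_one]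
  exact le_rfl

open scoped Classical in
lemma Z_sq (st : Strategy n) :
    (∑ σ : Ord n, (if Fail st σ then 1 else 0) * W 0 σ) ^ 2 ≤
      (univ.filter (Fail st)).card * (8 * n ^ 2 * Fintype.card (Ord n)) := by
  refine (sum_mul_sq_le_sq_mul_sq _ _ _).trans ?_
  refine Nat.mul_le_mul ?_ sum_W_sq
  rw [card_filter]
  apply sum_le_sum
  intro σ _
  split_ifs <;> simp

lemma final_arith (ε C n E p a Z D X : ℝ) (hε : 0 < ε) (hε1 : ε ≤ 3 / 4) (hC : 0 < C)
    (hn : 3 ≤ n) (hnε : 100 ≤ ε * n) (hE : E = n * (n - 1) / 2)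
    (h1 : C * n ≤ X + C * ((3 / 4 - ε) * n) + D)
    (h2 : D * (2 * n - 3) ≤ E * C)
    (h3 : X ≤ n * p + n * a + C + Z) (h5 : a * (2 * n - 3) ≤ C) (ha : 0 ≤ a) (hp0 : 0 ≤ p)
    (h6 : Z ^ 2 ≤ p * (8 * n ^ 2 * C)) (hp : p < ε ^ 3 / 100 * C) : False := by
  have hd : D ≤ C * (n / 4 + 1 / 2) := by
    have h : D * (2 * n - 3) ≤ C * (n / 4 + 1 / 2) * (2 * n - 3) := by
      refine h2.trans ?_
      rw [hE]
      have : n * (n - 1) / 2 ≤ (n / 4 + 1 / 2) * (2 * n - 3) := by nlinarith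
      nlinarith
    exact le_of_mul_le_mul_right h (by linarith)
  have hna : n * a ≤ C := by nlinarith
  have hp1 : ε ^ 3 ≤ 3 / 4 * ε ^ 2 := by nlinarith [sq_nonneg ε]
  have hp2 : p ≤ 3 / 400 * ε ^ 2 * C := by nlinarith
  have hp3 : p ≤ 1 / 100 * ε * C := by
    refine hp2.trans ?_
    have : 3 / 400 * ε ^ 2 ≤ 1 / 100 * ε := by nlinarith
    nlinarith
  have hZ : C * (ε * n) * (9 / 10) ≤ Z := by
    have e1 : n * p ≤ n * (1 / 100 * ε * C) := mul_le_mul_of_nonneg_left hp3 (by linarith)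
    have e2 : C * 100 ≤ C * (ε * n) := mul_le_mul_of_nonneg_left hnε hC.le
    nlinarith
  have hpos : 0 < C * (ε * n) := by positivity
  have hZ2 : (C * (ε * n) * (9 / 10)) ^ 2 ≤ Z ^ 2 := pow_le_pow_left₀ (by positivity) hZ 2
  have h8 : p * (8 * n ^ 2 * C) ≤ (3 / 400 * ε ^ 2 * C) * (8 * n ^ 2 * C) :=
    mul_le_mul_of_nonneg_right hp2 (by positivity)
  have h9 : 0 < (C * (ε * n)) ^ 2 := by positivity
  nlinarith

/-- For every constant `ε > 0` and all sufficiently large `n`: every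
deterministic online strategy of Builder which never purchases more than `(3/4 − ε)·n`
edges among `e_1, …, e_{τ_1}` produces, with probability at least `ε³/100`, a graph
`B_{τ_1}` with an isolated vertex. -/
theorem any_cheap_strategy_fails (ε : ℝ) (hε : 0 < ε) :
    ∀ᶠ n : ℕ in Filter.atTop, ∀ st : Strategy n,
      (∀ σ : Ord n, ((buy st σ (tau 1 σ)).card : ℝ) ≤ (3 / 4 - ε) * n) →
      ε ^ 3 / 100 ≤ Pr (fun σ : Ord n => ∃ v : Fin n, deg (buy st σ (tau 1 σ)) v = 0) := by
  classical
  filter_upwards [eventually_ge_atTop 3, eventually_ge_atTop ⌈100 / ε⌉₊] with n hn hn2 st hst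
  by_contra hcon
  push Not at hcon
  have hC : 0 < Fintype.card (Ord n) := by
    have := nonempty_ord n
    exact Fintype.card_pos
  have hnR : (3 : ℝ) ≤ n := by exact_mod_cast hn
  have hε1 : ε ≤ 3 / 4 := by
    obtain ⟨σ⟩ := nonempty_ord n
    have h1 := hst σ
    have h2 : (0 : ℝ) ≤ ((buy st σ (tau 1 σ)).card : ℝ) := by positivity
    by_contra h
    push Not at h
    nlinarith
  have hnε : 100 ≤ ε * n := by
    have := Nat.le_of_ceil_le hn2
    rw [div_le_iff₀ hε] at this
    linarith
  have hCR : (0 : ℝ) < (Fintype.card (Ord n) : ℝ) := by exact_mod_cast hC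
  have h23 : ((2 * n - 3 : ℕ) : ℝ) = 2 * n - 3 := by
    rw [Nat.cast_sub (by omega)]; push_cast; ring
  have hE : ((Fintype.card (EdgeType n) : ℕ) : ℝ) = n * (n - 1) / 2 := by
    rw [Sym2.card_subtype_not_diag, Fintype.card_fin, Nat.cast_choose_two]
  refine final_arith ε (Fintype.card (Ord n)) n (Fintype.card (EdgeType n))
    ((univ.filter (Fail st)).card)
    ((univ.filter (fun σ : Ord n => ∃ e, Dp σ e ∧ QA e σ)).card)
    ((∑ σ : Ord n, (if Fail st σ then 1 else 0) * W 0 σ : ℕ))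
    ((∑ σ : Ord n, (univ.filter (Dp σ)).card : ℕ))
    ((∑ σ : Ord n, (univ.filter (XX st σ)).card : ℕ))
    hε hε1 hCR hnR hnε hE ?_ ?_ ?_ ?_ (by positivity) (by positivity) ?_ ?_
  · have : ∀ σ : Ord n, (n : ℝ) ≤ ((univ.filter (XX st σ)).card : ℝ) + (3 / 4 - ε) * n +
        ((univ.filter (Dp σ)).card : ℝ) := by
      intro σ
      have h1 : (n : ℝ) ≤ ((univ.filter (XX st σ)).card : ℝ) + ((buy st σ (tau 1 σ)).card : ℝ) +
        ((univ.filter (Dp σ)).card : ℝ) := by exact_mod_cast card_XX (by omega) st σ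
      have h2 := hst σ
      linarith
    have h3 := sum_le_sum (fun σ (_ : σ ∈ (univ : Finset (Ord n))) => this σ)
    simp only [sum_add_distrib, sum_const, card_univ, nsmul_eq_mul] at h3
    push_cast
    linarith
  · rw [← h23]; exact_mod_cast sum_D
  · exact_mod_cast sum_XX (by omega) st
  · rw [← h23]; exact_mod_cast card_A
  · exact_mod_cast Z_sq st
  · unfold Pr at hcon
    rw [div_lt_iff₀ hCR] at hcon
    refine lt_of_eq_of_lt (congrArg (fun s : Finset (Ord n) => (s.card : ℝ)) ?_) hcon
    ext σ
    simp [Fail]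

end RGP
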